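/- Let n ≥ 2 be an integer. For all s ∈ (0,1) and α ∈ [0,1], the quantity F(s,α) = Σ_{k=0}^∞ [(n)_k/((n/2+1)_k (k+1))] · Q_k(s,α) is nonnegative, where Q_k(s,α) = (1−s)^{k+1}·B_α(n/2, n/2) + s^{k+1}·B_{1−α}(n/2, n/2) + B_α(n/2+k+1, n/2) − B_α(n/2, n/2+k+1). -/

import Mathlib

open Real

noncomputable def poch (x : ℝ) (k : ℕ) : ℝ := ∏ i ∈ Finset.range k, (x + i)

noncomputable def incBeta (x α β : ℝ) : ℝ := ∫ t in (0:ℝ)..x, t ^ (α - 1) * (1 - t) ^ (β - 1)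

open Finset in
theorem poch_succ (x : ℝ) (k : ℕ) : poch x (k + 1) = poch x k * (x + k) :=
  prod_range_succ _ _

theorem poch_pos {x : ℝ} (hx : 0 < x) (k : ℕ) : 0 < poch x k :=
  Finset.prod_pos fun _ _ => by positivity

/-- The symmetric beta density `t ^ (a - 1) * (1 - t) ^ (a - 1)`. -/
noncomputable def symBetaWeight (a t : ℝ) : ℝ := t ^ (a - 1) * (1 - t) ^ (a - 1)

/-- The incomplete `k`-th moment of the symmetric beta density. -/
noncomputable def symBetaMoment (a : ℝ) (k : ℕ) (x : ℝ) : ℝ :=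
  ∫ t in (0:ℝ)..x, symBetaWeight a t * t ^ k

/-- The Taylor coefficients of the hypergeometric function `₂F₁(2a, 1; a + 1; x)`. -/
noncomputable def hypCoeff (a : ℝ) (k : ℕ) : ℝ := poch (2 * a) k / poch (a + 1) k

/-- The truncated Taylor series of `₂F₁(2a, 1; a + 1; x)`. -/
noncomputable def hypTrunc (a : ℝ) (N : ℕ) (x : ℝ) : ℝ :=
  ∑ k ∈ Finset.range N, hypCoeff a k * x ^ k

/-- The primitive of `hypTrunc a N` vanishing at `0`. -/
noncomputable def hypTruncPrim (a : ℝ) (N : ℕ) (x : ℝ) : ℝ :=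
  ∑ k ∈ Finset.range N, hypCoeff a k / (k + 1) * x ^ (k + 1)

/-- The truncation of the series `F(s, x)`, rewritten with `hypTruncPrim`. -/
noncomputable def truncF (a : ℝ) (N : ℕ) (s x : ℝ) : ℝ :=
  hypTruncPrim a N (1 - s) * symBetaMoment a 0 x + hypTruncPrim a N s * symBetaMoment a 0 (1 - x)
    + ∫ t in (0:ℝ)..x, symBetaWeight a t * (hypTruncPrim a N t - hypTruncPrim a N (1 - t))

section

variable {a : ℝ}

theorem hypCoeff_pos (ha : 1 ≤ a) (k : ℕ) : 0 < hypCoeff a k :=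
  div_pos (poch_pos (by linarith) k) (poch_pos (by linarith) k)

theorem hypCoeff_succ (ha : 1 ≤ a) (k : ℕ) :
    hypCoeff a (k + 1) * (a + 1 + k) = hypCoeff a k * (2 * a + k) := by
  have h1 := (poch_pos (x := a + 1) (by linarith) k).ne'
  have h2 : a + 1 + k ≠ 0 := by positivity
  unfold hypCoeff
  rw [poch_succ, poch_succ]
  field_simp

theorem continuous_symBetaWeight (ha : 1 ≤ a) : Continuous (symBetaWeight a) := by
  have h : Continuous fun t : ℝ => t ^ (a - 1) :=
    Real.continuous_rpow_const (by linarith)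
  exact h.mul (h.comp (continuous_const.sub continuous_id))

theorem symBetaWeight_nonneg {t : ℝ} (h0 : 0 ≤ t) (h1 : t ≤ 1) : 0 ≤ symBetaWeight a t :=
  mul_nonneg (rpow_nonneg h0 _) (rpow_nonneg (by linarith) _)

theorem symBetaWeight_one_sub (t : ℝ) : symBetaWeight a (1 - t) = symBetaWeight a t := by
  simp [symBetaWeight, mul_comm]

theorem hasDerivAt_hypTruncPrim (N : ℕ) (x : ℝ) :
    HasDerivAt (hypTruncPrim a N) (hypTrunc a N x) x := by
  unfold hypTruncPrim hypTrunc
  refine HasDerivAt.fun_sum fun k _ => ?_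
  refine ((hasDerivAt_pow (k + 1) x).const_mul (hypCoeff a k / (k + 1))).congr_deriv ?_
  have : (k : ℝ) + 1 ≠ 0 := by positivity
  push_cast
  field_simp

theorem continuous_hypTruncPrim (N : ℕ) : Continuous (hypTruncPrim a N) :=
  continuous_iff_continuousAt.2 fun x => (hasDerivAt_hypTruncPrim N x).continuousAt

theorem hypTruncPrim_mono (ha : 1 ≤ a) (N : ℕ) {x y : ℝ} (hx : 0 ≤ x) (hxy : x ≤ y) :
    hypTruncPrim a N x ≤ hypTruncPrim a N y := by
  refine Finset.sum_le_sum fun k _ => ?_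
  have := hypCoeff_pos ha k
  gcongr

theorem continuous_symBetaWeight_mul_pow (ha : 1 ≤ a) (k : ℕ) :
    Continuous fun t => symBetaWeight a t * t ^ k :=
  (continuous_symBetaWeight ha).mul (continuous_pow k)

theorem hasDerivAt_symBetaMoment (ha : 1 ≤ a) (k : ℕ) (x : ℝ) :
    HasDerivAt (symBetaMoment a k) (symBetaWeight a x * x ^ k) x :=
  (continuous_symBetaWeight_mul_pow ha k).integral_hasStrictDerivAt 0 x |>.hasDerivAt

theorem symBetaMoment_zero_nonneg {x : ℝ} (h0 : 0 ≤ x) (h1 : x ≤ 1) :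
    0 ≤ symBetaMoment a 0 x :=
  intervalIntegral.integral_nonneg h0 fun t ht => by
    simpa using symBetaWeight_nonneg ht.1 (ht.2.trans h1)

theorem symBetaMoment_sub (ha : 1 ≤ a) (k : ℕ) (x y : ℝ) :
    symBetaMoment a k y - symBetaMoment a k x = ∫ t in x..y, symBetaWeight a t * t ^ k :=
  intervalIntegral.integral_interval_sub_left
    ((continuous_symBetaWeight_mul_pow ha k).intervalIntegrable _ _)
    ((continuous_symBetaWeight_mul_pow ha k).intervalIntegrable _ _)

theorem symBetaMoment_le (ha : 1 ≤ a) (k : ℕ) {x : ℝ} (h0 : 0 ≤ x) (h1 : x ≤ 1) :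
    symBetaMoment a k x ≤ x ^ k * symBetaMoment a 0 x := by
  unfold symBetaMoment
  rw [← intervalIntegral.integral_const_mul]
  refine intervalIntegral.integral_mono_on h0
    ((continuous_symBetaWeight_mul_pow ha k).intervalIntegrable _ _)
    (((continuous_symBetaWeight_mul_pow ha 0).const_mul _).intervalIntegrable _ _) fun t ht => ?_
  rw [pow_zero, mul_one, mul_comm]
  exact mul_le_mul_of_nonneg_right (pow_le_pow_left₀ ht.1 ht.2 k)
    (symBetaWeight_nonneg ht.1 (ht.2.trans h1))

theorem pow_mul_symBetaMoment_sub_le (ha : 1 ≤ a) (k : ℕ) {x y : ℝ} (h0 : 0 ≤ x) (hxy : x ≤ y)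
    (h1 : y ≤ 1) :
    x ^ k * (symBetaMoment a 0 y - symBetaMoment a 0 x)
      ≤ symBetaMoment a k y - symBetaMoment a k x := by
  rw [symBetaMoment_sub ha, symBetaMoment_sub ha, ← intervalIntegral.integral_const_mul]
  refine intervalIntegral.integral_mono_on hxy
    (((continuous_symBetaWeight_mul_pow ha 0).const_mul _).intervalIntegrable _ _)
    ((continuous_symBetaWeight_mul_pow ha k).intervalIntegrable _ _) fun t ht => ?_
  rw [pow_zero, mul_one, mul_comm]
  exact mul_le_mul_of_nonneg_left (pow_le_pow_left₀ h0 ht.1 k)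
    (symBetaWeight_nonneg (h0.trans ht.1) (ht.2.trans h1))

/-- The conditional moments `E[t ^ k | t ≤ x]` increase with `x`. -/
theorem symBetaMoment_mul_le (ha : 1 ≤ a) (k : ℕ) {x y : ℝ} (h0 : 0 ≤ x) (hxy : x ≤ y)
    (h1 : y ≤ 1) :
    symBetaMoment a k x * symBetaMoment a 0 y ≤ symBetaMoment a k y * symBetaMoment a 0 x := by
  have hx := symBetaMoment_zero_nonneg (a := a) h0 (hxy.trans h1)
  have hle := symBetaMoment_le ha k h0 (hxy.trans h1)
  have hsub := pow_mul_symBetaMoment_sub_le ha k h0 hxy h1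
  have hinc : 0 ≤ symBetaMoment a 0 y - symBetaMoment a 0 x := by
    rw [symBetaMoment_sub ha]
    exact intervalIntegral.integral_nonneg hxy fun t ht => by
      simpa using symBetaWeight_nonneg (a := a) (h0.trans ht.1) (ht.2.trans h1)
  nlinarith [mul_le_mul_of_nonneg_right hle hinc, mul_le_mul_of_nonneg_left hsub hx]

theorem symBetaMoment_recurrence (ha : 1 ≤ a) (k : ℕ) {x : ℝ} (h0 : 0 ≤ x) (h1 : x ≤ 1) :
    x ^ a * (1 - x) ^ a * x ^ k
      = (a + k) * symBetaMoment a k x - (2 * a + k) * symBetaMoment a (k + 1) x := by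
  have hc := continuous_symBetaWeight_mul_pow ha
  have key : ∫ t in (0:ℝ)..x, ((a + k) * (symBetaWeight a t * t ^ k)
      - (2 * a + k) * (symBetaWeight a t * t ^ (k + 1)))
      = x ^ a * (1 - x) ^ a * x ^ k - (0:ℝ) ^ a * (1 - 0) ^ a * 0 ^ k := by
    refine intervalIntegral.integral_eq_sub_of_hasDerivAt
      (f := fun t : ℝ => t ^ a * (1 - t) ^ a * t ^ k) (fun t ht => ?_)
      ((((hc k).const_mul _).sub ((hc (k + 1)).const_mul _)).intervalIntegrable _ _)
    rw [Set.uIcc_of_le h0] at ht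
    have ht1 : 0 ≤ 1 - t := by linarith [ht.2]
    have e1 : t ^ a = t ^ (a - 1) * t := by
      rw [← rpow_add_one' ht.1 (by linarith), sub_add_cancel]
    have e2 : (1 - t) ^ a = (1 - t) ^ (a - 1) * (1 - t) := by
      rw [← rpow_add_one' ht1 (by linarith), sub_add_cancel]
    have d1 : HasDerivAt (fun t : ℝ => t ^ a) (a * t ^ (a - 1)) t :=
      hasDerivAt_rpow_const (Or.inr ha)
    have d2 : HasDerivAt (fun t : ℝ => (1 - t) ^ a) (a * (1 - t) ^ (a - 1) * (-1)) t :=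
      (hasDerivAt_rpow_const (x := 1 - t) (p := a) (Or.inr ha)).comp t
        ((hasDerivAt_id t).const_sub 1)
    refine ((d1.mul d2).mul (hasDerivAt_pow k t)).congr_deriv ?_
    have e3 : t * ((k : ℝ) * t ^ (k - 1)) = k * t ^ k := by
      cases k with
      | zero => simp
      | succ k => simp only [Nat.add_sub_cancel]; ring
    simp only [Pi.mul_apply, symBetaWeight]
    rw [e1, e2]
    linear_combination t ^ (a - 1) * ((1 - t) ^ (a - 1) * (1 - t)) * e3
  rw [zero_rpow (by linarith), zero_mul, zero_mul, sub_zero,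
    intervalIntegral.integral_sub (((hc k).const_mul _).intervalIntegrable _ _)
      (((hc (k + 1)).const_mul _).intervalIntegrable _ _),
    intervalIntegral.integral_const_mul, intervalIntegral.integral_const_mul] at key
  exact key.symm

theorem hypTrunc_eq (ha : 1 ≤ a) (N : ℕ) {x : ℝ} (h0 : 0 ≤ x) (h1 : x ≤ 1) :
    x ^ a * (1 - x) ^ a * hypTrunc a N x
      = a * symBetaMoment a 0 x - hypCoeff a N * (a + N) * symBetaMoment a N x := by
  induction N with
  | zero => simp [hypTrunc, hypCoeff, poch]
  | succ N ih =>
    have hr := symBetaMoment_recurrence ha N h0 h1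
    have hs := hypCoeff_succ ha N
    have : hypTrunc a (N + 1) x = hypTrunc a N x + hypCoeff a N * x ^ N :=
      Finset.sum_range_succ _ _
    rw [this]
    push_cast
    linear_combination ih + hypCoeff a N * hr + symBetaMoment a (N + 1) x * hs

theorem hasDerivAt_truncF (ha : 1 ≤ a) (N : ℕ) (s x : ℝ) :
    HasDerivAt (truncF a N s)
      (symBetaWeight a x * ((hypTruncPrim a N x - hypTruncPrim a N (1 - x))
        - (hypTruncPrim a N s - hypTruncPrim a N (1 - s)))) x := by
  have hM := hasDerivAt_symBetaMoment ha 0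
  have hG := continuous_hypTruncPrim (a := a) N
  have d2 := (hM (1 - x)).comp x ((hasDerivAt_id x).const_sub 1)
  have hI : Continuous fun t => symBetaWeight a t *
      (hypTruncPrim a N t - hypTruncPrim a N (1 - t)) :=
    (continuous_symBetaWeight ha).mul (hG.sub (hG.comp (continuous_const.sub continuous_id)))
  refine ((((hM x).const_mul (hypTruncPrim a N (1 - s))).add
    (d2.const_mul (hypTruncPrim a N s))).add
    (hI.integral_hasStrictDerivAt 0 x).hasDerivAt).congr_deriv ?_
  simp only [symBetaWeight_one_sub]
  ring

theorem hasDerivAt_truncF_diag (ha : 1 ≤ a) (N : ℕ) (x : ℝ) :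
    HasDerivAt (fun x => truncF a N x x)
      (hypTrunc a N x * symBetaMoment a 0 (1 - x)
        - hypTrunc a N (1 - x) * symBetaMoment a 0 x) x := by
  have hM := hasDerivAt_symBetaMoment ha 0
  have hG := hasDerivAt_hypTruncPrim (a := a) N
  have hGc := continuous_hypTruncPrim (a := a) N
  have hs := (hasDerivAt_id x).const_sub 1
  have hI : Continuous fun t => symBetaWeight a t *
      (hypTruncPrim a N t - hypTruncPrim a N (1 - t)) :=
    (continuous_symBetaWeight ha).mul (hGc.sub (hGc.comp (continuous_const.sub continuous_id)))
  refine (((((hG (1 - x)).comp x hs).mul (hM x)).add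
    ((hG x).mul ((hM (1 - x)).comp x hs))).add
    (hI.integral_hasStrictDerivAt 0 x).hasDerivAt).congr_deriv ?_
  simp only [symBetaWeight_one_sub, Function.comp_apply]
  ring

theorem truncF_diag_deriv_eq (ha : 1 ≤ a) (N : ℕ) {x : ℝ} (h0 : 0 ≤ x) (h1 : x ≤ 1) :
    x ^ a * (1 - x) ^ a * (hypTrunc a N x * symBetaMoment a 0 (1 - x)
        - hypTrunc a N (1 - x) * symBetaMoment a 0 x)
      = hypCoeff a N * (a + N) * (symBetaMoment a N (1 - x) * symBetaMoment a 0 x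
        - symBetaMoment a N x * symBetaMoment a 0 (1 - x)) := by
  have e1 := hypTrunc_eq ha N h0 h1
  have e2 := hypTrunc_eq ha N (x := 1 - x) (by linarith) (by linarith)
  rw [sub_sub_cancel] at e2
  linear_combination symBetaMoment a 0 (1 - x) * e1 - symBetaMoment a 0 x * e2

theorem truncF_diag_zero (N : ℕ) : truncF a N 0 0 = 0 := by
  simp [truncF, symBetaMoment, hypTruncPrim]

theorem truncF_diag_one (ha : 1 ≤ a) (N : ℕ) : truncF a N 1 1 = 0 := by
  have hG := continuous_hypTruncPrim (a := a) N
  have hw := continuous_symBetaWeight ha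
  have hI1 : Continuous fun t => symBetaWeight a t * hypTruncPrim a N t := hw.mul hG
  have hI2 : Continuous fun t => symBetaWeight a t * hypTruncPrim a N (1 - t) :=
    hw.mul (hG.comp (continuous_const.sub continuous_id))
  have h := intervalIntegral.integral_comp_sub_left (a := 0) (b := 1)
    (fun t => symBetaWeight a t * hypTruncPrim a N t) 1
  simp only [symBetaWeight_one_sub, sub_self, sub_zero] at h
  have h2 : ∫ t in (0:ℝ)..1, symBetaWeight a t * (hypTruncPrim a N t - hypTruncPrim a N (1 - t))
      = 0 := by
    simp only [mul_sub]
    rw [intervalIntegral.integral_sub (hI1.intervalIntegrable _ _) (hI2.intervalIntegrable _ _),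
      h, sub_self]
  rw [truncF, h2]
  simp [symBetaMoment, hypTruncPrim]

theorem truncF_diag_nonneg (ha : 1 ≤ a) (N : ℕ) {x : ℝ} (h0 : 0 ≤ x) (h1 : x ≤ 1) :
    0 ≤ truncF a N x x := by
  have hd := hasDerivAt_truncF_diag ha N
  have hcont : Continuous fun x => truncF a N x x :=
    continuous_iff_continuousAt.2 fun x => (hd x).continuousAt
  have hc : 0 ≤ hypCoeff a N * (a + N) :=
    mul_nonneg (hypCoeff_pos ha N).le (by positivity)
  have hpos : ∀ {y : ℝ}, 0 < y → y < 1 → 0 < y ^ a * (1 - y) ^ a := fun hy0 hy1 =>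
    mul_pos (rpow_pos_of_pos hy0 _) (rpow_pos_of_pos (by linarith) _)
  rcases le_total x (1 / 2) with hx | hx
  · have hmono : MonotoneOn (fun x => truncF a N x x) (Set.Icc 0 (1 / 2)) := by
      refine monotoneOn_of_deriv_nonneg (convex_Icc _ _) hcont.continuousOn
        (fun y _ => (hd y).differentiableAt.differentiableWithinAt) fun y hy => ?_
      rw [interior_Icc] at hy
      rw [(hd y).deriv]
      refine nonneg_of_mul_nonneg_right ?_ (hpos hy.1 (by linarith [hy.2]))
      rw [truncF_diag_deriv_eq ha N hy.1.le (by linarith [hy.2])]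
      refine mul_nonneg hc (sub_nonneg.2 ?_)
      exact symBetaMoment_mul_le ha N hy.1.le (by linarith [hy.2]) (by linarith [hy.1])
    simpa [truncF_diag_zero] using hmono ⟨le_rfl, by norm_num⟩ ⟨h0, hx⟩ h0
  · have hanti : AntitoneOn (fun x => truncF a N x x) (Set.Icc (1 / 2) 1) := by
      refine antitoneOn_of_deriv_nonpos (convex_Icc _ _) hcont.continuousOn
        (fun y _ => (hd y).differentiableAt.differentiableWithinAt) fun y hy => ?_
      rw [interior_Icc] at hy
      rw [(hd y).deriv]
      refine nonpos_of_mul_nonpos_right ?_ (hpos (by linarith [hy.1]) hy.2)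
      rw [truncF_diag_deriv_eq ha N (by linarith [hy.1]) hy.2.le]
      refine mul_nonpos_of_nonneg_of_nonpos hc (sub_nonpos.2 ?_)
      exact symBetaMoment_mul_le ha N (by linarith [hy.2]) (by linarith [hy.1]) hy.2.le
    simpa [truncF_diag_one ha] using hanti ⟨hx, h1⟩ ⟨by norm_num, le_rfl⟩ h1

theorem truncF_nonneg (ha : 1 ≤ a) (N : ℕ) {s x : ℝ} (hs0 : 0 ≤ s) (hs1 : s ≤ 1)
    (h0 : 0 ≤ x) (h1 : x ≤ 1) : 0 ≤ truncF a N s x := by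
  have hd := hasDerivAt_truncF ha N s
  have hcont : Continuous (truncF a N s) :=
    continuous_iff_continuousAt.2 fun x => (hd x).continuousAt
  refine (truncF_diag_nonneg ha N hs0 hs1).trans ?_
  rcases le_total x s with hx | hx
  · have hanti : AntitoneOn (truncF a N s) (Set.Icc 0 s) := by
      refine antitoneOn_of_deriv_nonpos (convex_Icc _ _) hcont.continuousOn
        (fun y _ => (hd y).differentiableAt.differentiableWithinAt) fun y hy => ?_
      rw [interior_Icc] at hy
      rw [(hd y).deriv]
      refine mul_nonpos_of_nonneg_of_nonpos
        (symBetaWeight_nonneg hy.1.le (hy.2.le.trans hs1)) ?_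
      have g1 := hypTruncPrim_mono ha N hy.1.le hy.2.le
      have g2 := hypTruncPrim_mono ha N (x := 1 - s) (y := 1 - y) (by linarith)
        (by linarith [hy.2])
      linarith
    exact hanti ⟨h0, hx⟩ ⟨hs0, le_rfl⟩ hx
  · have hmono : MonotoneOn (truncF a N s) (Set.Icc s 1) := by
      refine monotoneOn_of_deriv_nonneg (convex_Icc _ _) hcont.continuousOn
        (fun y _ => (hd y).differentiableAt.differentiableWithinAt) fun y hy => ?_
      rw [interior_Icc] at hy
      rw [(hd y).deriv]
      refine mul_nonneg (symBetaWeight_nonneg (hs0.trans hy.1.le) hy.2.le) ?_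
      have g1 := hypTruncPrim_mono ha N hs0 hy.1.le
      have g2 := hypTruncPrim_mono ha N (x := 1 - y) (y := 1 - s) (by linarith [hy.2])
        (by linarith [hy.1])
      linarith
    exact hmono ⟨le_rfl, hs1⟩ ⟨hx, h1⟩ hx

theorem incBeta_self (x : ℝ) : incBeta x a a = symBetaMoment a 0 x := by
  simp [incBeta, symBetaMoment, symBetaWeight]

theorem rpow_add_natCast_add_one_sub_one (ha : 1 ≤ a) (k : ℕ) {t : ℝ} (ht : 0 ≤ t) :
    t ^ (a + k + 1 - 1) = t ^ (a - 1) * t ^ (k + 1) := by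
  rw [← rpow_natCast, ← rpow_add_of_nonneg ht (by linarith) (by positivity)]
  congr 1
  push_cast
  ring

theorem incBeta_add_left (ha : 1 ≤ a) (k : ℕ) {x : ℝ} (h0 : 0 ≤ x) :
    incBeta x (a + k + 1) a = ∫ t in (0:ℝ)..x, symBetaWeight a t * t ^ (k + 1) := by
  refine intervalIntegral.integral_congr fun t ht => ?_
  rw [Set.uIcc_of_le h0] at ht
  simp only [symBetaWeight, rpow_add_natCast_add_one_sub_one ha k ht.1]
  ring

theorem incBeta_add_right (ha : 1 ≤ a) (k : ℕ) {x : ℝ} (h0 : 0 ≤ x) (h1 : x ≤ 1) :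
    incBeta x a (a + k + 1) = ∫ t in (0:ℝ)..x, symBetaWeight a t * (1 - t) ^ (k + 1) := by
  refine intervalIntegral.integral_congr fun t ht => ?_
  rw [Set.uIcc_of_le h0] at ht
  simp only [symBetaWeight,
    rpow_add_natCast_add_one_sub_one ha k (sub_nonneg.2 (ht.2.trans h1))]
  ring

theorem sum_eq_truncF (ha : 1 ≤ a) (N : ℕ) (s : ℝ) {x : ℝ} (h0 : 0 ≤ x) (h1 : x ≤ 1) :
    ∑ k ∈ Finset.range N, hypCoeff a k / (k + 1) *
        ((1 - s) ^ (k + 1) * incBeta x a a + s ^ (k + 1) * incBeta (1 - x) a a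
          + incBeta x (a + k + 1) a - incBeta x a (a + k + 1))
      = truncF a N s x := by
  have hw := continuous_symBetaWeight ha
  have hp : ∀ k : ℕ, Continuous fun t : ℝ => symBetaWeight a t * t ^ (k + 1) := fun k =>
    continuous_symBetaWeight_mul_pow ha (k + 1)
  have hq : ∀ k : ℕ, Continuous fun t : ℝ => symBetaWeight a t * (1 - t) ^ (k + 1) := fun k =>
    hw.mul ((continuous_const.sub continuous_id).pow (k + 1))
  have hint : ∫ t in (0:ℝ)..x, symBetaWeight a t *
      (hypTruncPrim a N t - hypTruncPrim a N (1 - t))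
      = ∑ k ∈ Finset.range N, hypCoeff a k / (k + 1) *
        (incBeta x (a + k + 1) a - incBeta x a (a + k + 1)) := by
    have : ∀ t, symBetaWeight a t * (hypTruncPrim a N t - hypTruncPrim a N (1 - t))
        = ∑ k ∈ Finset.range N, hypCoeff a k / (k + 1) *
          (symBetaWeight a t * t ^ (k + 1) - symBetaWeight a t * (1 - t) ^ (k + 1)) := fun t => by
      rw [hypTruncPrim, hypTruncPrim, ← Finset.sum_sub_distrib, Finset.mul_sum]
      exact Finset.sum_congr rfl fun k _ => by ring
    simp only [this]
    refine (intervalIntegral.integral_finsetSum fun k _ =>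
      (((hp k).sub (hq k)).const_mul _).intervalIntegrable _ _).trans ?_
    refine Finset.sum_congr rfl fun k _ => ?_
    simp only [Pi.sub_apply]
    rw [intervalIntegral.integral_const_mul, intervalIntegral.integral_sub
      ((hp k).intervalIntegrable _ _) ((hq k).intervalIntegrable _ _),
      incBeta_add_left ha k h0, incBeta_add_right ha k h0 h1]
  rw [truncF, hint, hypTruncPrim, hypTruncPrim, Finset.sum_mul, Finset.sum_mul,
    ← Finset.sum_add_distrib, ← Finset.sum_add_distrib]
  refine Finset.sum_congr rfl fun k _ => ?_
  rw [incBeta_self, incBeta_self]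
  ring

end

theorem tsum_nonneg_of_sum_range_nonneg {f : ℕ → ℝ}
    (h : ∀ N, 0 ≤ ∑ k ∈ Finset.range N, f k) : 0 ≤ ∑' k, f k := by
  by_cases hf : Summable f
  · exact ge_of_tendsto' hf.hasSum.tendsto_sum_nat h
  · rw [tsum_eq_zero_of_not_summable hf]

theorem stmt_17 (n : ℕ) (hn : 2 ≤ n) (s α : ℝ) (hs : s ∈ Set.Ioo 0 1) (hα : α ∈ Set.Icc 0 1) :
    0 ≤ ∑' k : ℕ,
        poch n k / (poch ((n : ℝ) / 2 + 1) k * ((k : ℝ) + 1)) *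
          ((1 - s) ^ (k + 1) * incBeta α ((n : ℝ) / 2) ((n : ℝ) / 2)
            + s ^ (k + 1) * incBeta (1 - α) ((n : ℝ) / 2) ((n : ℝ) / 2)
            + incBeta α ((n : ℝ) / 2 + k + 1) ((n : ℝ) / 2)
            - incBeta α ((n : ℝ) / 2) ((n : ℝ) / 2 + k + 1)) := by
  have ha : (1 : ℝ) ≤ n / 2 := by
    have : (2 : ℝ) ≤ n := by exact_mod_cast hn
    linarith
  refine tsum_nonneg_of_sum_range_nonneg fun N => ?_
  have h := truncF_nonneg ha N hs.1.le hs.2.le hα.1 hα.2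
  rw [← sum_eq_truncF ha N s hα.1 hα.2] at h
  simpa only [hypCoeff, mul_div_cancel₀ (n : ℝ) (two_ne_zero' ℝ), div_div] using h
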